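/- arXiv:1602.05062 — 2 statements merged into one kernel-verified Lean document; each statement's English description precedes it below -/
import Mathlib

section
/- Let a and b be natural numbers. If there exists a quasi-isometric embedding f : ℤ^a → ℤ^b, where ℤ^a and ℤ^b carry the sup metrics d(r,s) = max_i |r_i − s_i|, then a ≤ b. -/
/-- A map `f : X → Y` between metric spaces is a quasi-isometric embedding if there are
constants `l ≥ 1` and `C ≥ 0` such that
`l⁻¹ * dist x x' - C ≤ dist (f x) (f x') ≤ l * dist x x' + C` for all `x x'`.
Here `Fin n → ℤ` carries the sup metric `dist r s = max_i |r i - s i|`. -/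
def IsQIEmbedding {X Y : Type*} [MetricSpace X] [MetricSpace Y] (f : X → Y) : Prop :=
  ∃ l C : ℝ, 1 ≤ l ∧ 0 ≤ C ∧ ∀ x x' : X,
    l⁻¹ * dist x x' - C ≤ dist (f x) (f x') ∧ dist (f x) (f x') ≤ l * dist x x' + C

/-- An injective map `ℤ^a → ℤ^b` that is Lipschitz for the sup metrics forces `a ≤ b`, by comparing
the growth of balls. -/
theorem le_of_injective_of_dist_le {a b : ℕ} (g : (Fin a → ℤ) → (Fin b → ℤ))
    (hg : Function.Injective g) (L : ℕ) (hL : ∀ x x', dist (g x) (g x') ≤ L * dist x x') :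
    a ≤ b := by
  have hcard (n : ℕ) : (n + 1) ^ a ≤ (2 * (L * n) + 1) ^ b := by
    have hmaps : ∀ x ∈ Finset.Icc (0 : Fin a → ℤ) (fun _ => (n : ℤ)),
        g x ∈ Finset.Icc (fun i => g 0 i - (L * n : ℤ)) (fun i => g 0 i + (L * n : ℤ)) := by
      intro x hx
      rw [Finset.mem_Icc] at hx
      have hx0 : dist x 0 ≤ n := by
        refine (dist_pi_le_iff (Nat.cast_nonneg n)).2 fun i => ?_
        have h0 : 0 ≤ x i := hx.1 i
        have h1 : x i ≤ n := hx.2 i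
        rw [Int.dist_eq, abs_le]
        simp only [Pi.zero_apply, Int.cast_zero, sub_zero]
        constructor
        · have : (0 : ℝ) ≤ x i := by exact_mod_cast h0
          linarith [(Nat.cast_nonneg n : (0 : ℝ) ≤ n)]
        · exact_mod_cast h1
      have hcoord (i : Fin b) : |g x i - g 0 i| ≤ (L * n : ℤ) := by
        have h : dist (g x i) (g 0 i) ≤ L * n :=
          (dist_le_pi_dist (g x) (g 0) i).trans
            ((hL x 0).trans (mul_le_mul_of_nonneg_left hx0 (Nat.cast_nonneg L)))
        rw [Int.dist_eq] at h
        exact_mod_cast h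
      rw [Finset.mem_Icc]
      constructor <;> intro i <;> have := abs_le.1 (hcoord i) <;> dsimp only <;> linarith
    have h := Finset.card_le_card_of_injOn g hmaps hg.injOn
    rw [Pi.card_Icc, Pi.card_Icc] at h
    have hside (i : Fin b) :
        (g 0 i + (L * n : ℤ) + 1 - (g 0 i - (L * n : ℤ))).toNat = 2 * (L * n) + 1 := by
      rw [show g 0 i + (L * n : ℤ) + 1 - (g 0 i - (L * n : ℤ)) = ((2 * (L * n) + 1 : ℕ) : ℤ) by
        push_cast; ring, Int.toNat_natCast]
    have hside' : ((n : ℤ) + 1).toNat = n + 1 := by omega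
    simpa [Int.card_Icc, hside, hside'] using h
  by_contra! hab
  set N := (2 * L + 1) ^ b with hN
  have hle : (N + 1) ^ b * (N + 1) ≤ (N + 1) ^ b * N :=
    calc (N + 1) ^ b * (N + 1) = (N + 1) ^ (b + 1) := (pow_succ _ _).symm
      _ ≤ (N + 1) ^ a := Nat.pow_le_pow_right (Nat.succ_pos N) hab
      _ ≤ (2 * (L * N) + 1) ^ b := hcard N
      _ ≤ ((N + 1) * (2 * L + 1)) ^ b := Nat.pow_le_pow_left (by nlinarith) b
      _ = (N + 1) ^ b * N := by rw [mul_pow, hN]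
  exact absurd (Nat.le_of_mul_le_mul_left hle (by positivity)) (by omega)

/-- If there is a quasi-isometric embedding `ℤ^a → ℤ^b` (sup metrics), then `a ≤ b`. -/
theorem stmt3 (a b : ℕ) (f : (Fin a → ℤ) → (Fin b → ℤ)) (hf : IsQIEmbedding f) :
    a ≤ b := by
  obtain ⟨l, C, hl, hC, h⟩ := hf
  have hl0 : 0 < l := by linarith
  obtain ⟨m, hm⟩ := exists_nat_gt (l * C)
  obtain ⟨L, hL⟩ := exists_nat_ge (l * m + C)
  have hscale (x x' : Fin a → ℤ) : dist ((m : ℤ) • x) ((m : ℤ) • x') = m * dist x x' := by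
    rw [dist_eq_norm, dist_eq_norm, ← smul_sub, norm_smul]
    simp
  have hone {x x' : Fin a → ℤ} (hne : x ≠ x') : 1 ≤ dist x x' := by
    obtain ⟨i, hi⟩ := Function.ne_iff.1 hne
    exact (Int.pairwise_one_le_dist hi).trans (dist_le_pi_dist x x' i)
  refine le_of_injective_of_dist_le (fun x => f ((m : ℤ) • x)) (fun x x' hxx' => ?_) L
    fun x x' => ?_
  · by_contra hne
    have hlow := (h ((m : ℤ) • x) ((m : ℤ) • x')).1
    rw [show f ((m : ℤ) • x) = f ((m : ℤ) • x') from hxx', dist_self, hscale, sub_nonpos,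
      inv_mul_le_iff₀ hl0] at hlow
    nlinarith [hone hne, (Nat.cast_nonneg m : (0 : ℝ) ≤ m)]
  · rcases eq_or_ne x x' with rfl | hne
    · simp
    · have hup := (h ((m : ℤ) • x) ((m : ℤ) • x')).2
      rw [hscale] at hup
      nlinarith [hone hne]
end

section
/- Let X be a metric space, and let m, n be natural numbers. Suppose there exists a quasi-isometric embedding f : ℤ^m → X and a quasi-isometry g : X → ℤ^n, where ℤ^m and ℤ^n carry the sup metrics d(r,s) = max_i |r_i − s_i|. Then m ≤ n; consequently, if moreover n ≤ m, then X is quasi-isometric to ℤ^m. -/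
/-- A quasi-isometry is a quasi-isometric embedding whose image is coarsely dense:
there is `D ≥ 0` with every point of `Y` within distance `D` of the image of `f`. -/
def IsQuasiIsometry {X Y : Type*} [MetricSpace X] [MetricSpace Y] (f : X → Y) : Prop :=
  IsQIEmbedding f ∧ ∃ D : ℝ, 0 ≤ D ∧ ∀ y : Y, ∃ x : X, dist y (f x) ≤ D

theorem IsQIEmbedding.comp {X Y Z : Type*} [MetricSpace X] [MetricSpace Y] [MetricSpace Z]
    {g : Y → Z} {f : X → Y} (hg : IsQIEmbedding g) (hf : IsQIEmbedding f) :
    IsQIEmbedding (g ∘ f) := by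
  obtain ⟨l, C, hl, hC, hf⟩ := hf
  obtain ⟨l', C', hl', hC', hg⟩ := hg
  have hl'0 : 0 < l' := by linarith
  have hinv : l'⁻¹ ≤ 1 := inv_le_one_of_one_le₀ hl'
  refine ⟨l' * l, l' * C + C', one_le_mul_of_one_le_of_one_le hl' hl, by positivity,
    fun x x' => ⟨?_, ?_⟩⟩
  · have h1 := mul_le_mul_of_nonneg_left (hf x x').1 (inv_pos.2 hl'0).le
    have h2 := (hg (f x) (f x')).1
    have h3 : l'⁻¹ * C ≤ l' * C := mul_le_mul_of_nonneg_right (hinv.trans hl') hC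
    rw [mul_inv, Function.comp_apply, Function.comp_apply]
    linarith
  · have h1 := mul_le_mul_of_nonneg_left (hf x x').2 hl'0.le
    have h2 := (hg (f x) (f x')).2
    rw [Function.comp_apply, Function.comp_apply]
    linarith

/-- A finite type injecting into a sup-metric ball of radius `R` in `ℤ^n` has at most
`(2 * R + 1) ^ n` elements. -/
theorem card_le_of_injective_of_dist_le {α : Type*} [Fintype α] {n R : ℕ}
    {F : α → Fin n → ℤ} (hF : Function.Injective F) (c : Fin n → ℤ)
    (hR : ∀ a, dist (F a) c ≤ R) : Fintype.card α ≤ (2 * R + 1) ^ n := by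
  classical
  have hmem : ∀ a ∈ (Finset.univ : Finset α),
      F a ∈ Fintype.piFinset fun i => Finset.Icc (c i - R) (c i + R) := by
    intro a _
    rw [Fintype.mem_piFinset]
    intro i
    have h := (dist_le_pi_dist (F a) c i).trans (hR a)
    rw [Int.dist_eq] at h
    have h' : |F a i - c i| ≤ (R : ℤ) := by exact_mod_cast h
    rw [abs_le] at h'
    rw [Finset.mem_Icc]
    omega
  have hcard := Finset.card_le_card_of_injOn F hmem hF.injOn
  have hsize : ∀ i, (Finset.Icc (c i - R) (c i + R)).card = 2 * R + 1 := by
    intro i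
    rw [Int.card_Icc]
    omega
  simpa [Fintype.card_piFinset, hsize, -Int.card_Icc] using hcard

/-- A quasi-isometric embedding `ℤ^m → ℤ^n` forces `m ≤ n`, by comparing volume growth. -/
theorem IsQIEmbedding.le_of_int_pi {m n : ℕ} {h : (Fin m → ℤ) → Fin n → ℤ}
    (hh : IsQIEmbedding h) : m ≤ n := by
  obtain ⟨l, C, hl, hC, hh⟩ := hh
  have hl0 : 0 < l := by linarith
  obtain ⟨k, hk⟩ := exists_nat_gt (l * C)
  have hk0 : (0 : ℝ) < k := lt_of_le_of_lt (by positivity) hk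
  obtain ⟨B, hB⟩ := exists_nat_ge (l * k + C)
  have hgrowth : ∀ N : ℕ, (N + 1) ^ m ≤ ((2 * B + 1) * (N + 1)) ^ n := by
    intro N
    let e : (Fin m → Fin (N + 1)) → Fin m → ℤ := fun a i => k * (a i : ℕ)
    have hinj : Function.Injective (h ∘ e) := by
      intro a b hab
      by_contra hne
      obtain ⟨i, hi⟩ := Function.ne_iff.1 hne
      have hd : (k : ℝ) ≤ dist (e a) (e b) := by
        refine le_trans ?_ (dist_le_pi_dist (e a) (e b) i)
        have hi' : ((a i : ℕ) : ℤ) - (b i : ℕ) ≠ 0 := by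
          have := Fin.val_ne_of_ne hi
          omega
        have habs : (1 : ℝ) ≤ |((a i : ℕ) : ℝ) - (b i : ℕ)| := by
          exact_mod_cast Int.one_le_abs hi'
        simp only [e, Int.dist_eq]
        push_cast
        rw [← mul_sub, abs_mul, abs_of_pos hk0]
        exact le_mul_of_one_le_right hk0.le habs
      have h1 := (hh (e a) (e b)).1
      have hab' : h (e a) = h (e b) := hab
      rw [hab', dist_self] at h1
      have h2 : C < l⁻¹ * k := by
        rw [inv_mul_eq_div, lt_div_iff₀ hl0]
        linarith
      have h3 := mul_le_mul_of_nonneg_left hd (inv_pos.2 hl0).le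
      linarith
    have hbound : ∀ a, dist ((h ∘ e) a) (h 0) ≤ (B * (N + 1) : ℕ) := by
      intro a
      have hd : dist (e a) 0 ≤ k * N := by
        refine (dist_pi_le_iff (by positivity)).2 fun i => ?_
        have hi : ((a i : ℕ) : ℝ) ≤ N := by exact_mod_cast Nat.lt_succ_iff.1 (a i).2
        simp only [e, Int.dist_eq, Pi.zero_apply]
        push_cast
        rw [sub_zero, abs_of_nonneg (by positivity)]
        exact mul_le_mul_of_nonneg_left hi hk0.le
      calc dist (h (e a)) (h 0) ≤ l * dist (e a) 0 + C := (hh _ _).2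
        _ ≤ l * (k * N) + C := by gcongr
        _ ≤ (l * k + C) * (N + 1) := by
          have h1 : 0 ≤ l * k := by positivity
          have h2 : 0 ≤ C * N := by positivity
          linarith
        _ ≤ B * (N + 1) := by gcongr
        _ = (B * (N + 1) : ℕ) := by push_cast; rfl
    have hcard := card_le_of_injective_of_dist_le hinj (h 0) hbound
    rw [Fintype.card_fun, Fintype.card_fin, Fintype.card_fin] at hcard
    refine hcard.trans (Nat.pow_le_pow_left ?_ n)
    nlinarith
  by_contra! hnm
  have hle := (Nat.pow_le_pow_right (Nat.succ_pos _) hnm).trans (hgrowth ((2 * B + 1) ^ n))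
  rw [mul_pow, Nat.succ_eq_add_one, pow_succ, mul_comm] at hle
  have := Nat.le_of_mul_le_mul_right hle (by positivity)
  omega

/-- If there is a quasi-isometric embedding `ℤ^m → X` and a quasi-isometry `X → ℤ^n`
(sup metrics on `ℤ^m`, `ℤ^n`), then `m ≤ n`; and if moreover `n ≤ m`, then `X` is
quasi-isometric to `ℤ^m`. -/
theorem stmt5 {X : Type*} [MetricSpace X] (m n : ℕ)
    (f : (Fin m → ℤ) → X) (hf : IsQIEmbedding f)
    (g : X → (Fin n → ℤ)) (hg : IsQuasiIsometry g) :
    m ≤ n ∧ (n ≤ m → ∃ h : X → (Fin m → ℤ), IsQuasiIsometry h) := by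
  have hmn : m ≤ n := (hg.1.comp hf).le_of_int_pi
  refine ⟨hmn, fun hnm => ?_⟩
  obtain rfl := le_antisymm hmn hnm
  exact ⟨g, hg⟩
end
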